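/- Fix a real s > 1, an irrational ω = (ω₁, ω₂), and positive integers M, N with N ≥ 3M. Let T > 0 and let u : [0, T] → h^s(ℤ²) be infinitely differentiable as an h^s-valued map and solve the truncated resonant system at height N on [0, T]. Assume u_k(0) = 0 for every k ∈ ℤ² \ Q_M. Then for every k ∈ ℤ² \ Q_M and every n ∈ ℕ, the n-th time derivative satisfies (d/dt)ⁿ u_k(0) = 0. -/

import Mathlib

open scoped ComplexConjugate

/-- `ω = (ω₁, ω₂)` is irrational: `ω₁m₁ + ω₂m₂ ≠ 0` for every nonzero `(m₁, m₂) ∈ ℤ²`. -/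
def IsIrrationalPair (ω : ℝ × ℝ) : Prop :=
  ∀ m : ℤ × ℤ, m ≠ 0 → ω.1 * (m.1 : ℝ) + ω.2 * (m.2 : ℝ) ≠ 0

/-- The frequency `λ_k = ω₁(k⁽¹⁾)² + ω₂(k⁽²⁾)²` for `k ∈ ℤ²`. -/
noncomputable def freq (ω : ℝ × ℝ) (k : ℤ × ℤ) : ℝ :=
  ω.1 * (k.1 : ℝ) ^ 2 + ω.2 * (k.2 : ℝ) ^ 2

/-- The squared Euclidean norm `|k|² = (k⁽¹⁾)² + (k⁽²⁾)²` of `k ∈ ℤ²`. -/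
def enormSq (k : ℤ × ℤ) : ℤ := k.1 ^ 2 + k.2 ^ 2

/-- The set `R^N(k)` of resonant triples at height `N`:
`(k₁, k₂, k₃)` with `(k₁, k₂, k₃, k) ∈ R` and `|k₁|, |k₂|, |k₃|, |k| ≤ N`. -/
def RNset (ω : ℝ × ℝ) (N : ℕ) (k : ℤ × ℤ) : Set ((ℤ × ℤ) × (ℤ × ℤ) × (ℤ × ℤ)) :=
  {p | p.1 + p.2.1 = p.2.2 + k ∧
    freq ω p.1 + freq ω p.2.1 = freq ω p.2.2 + freq ω k ∧
    enormSq p.1 ≤ (N : ℤ) ^ 2 ∧ enormSq p.2.1 ≤ (N : ℤ) ^ 2 ∧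
    enormSq p.2.2 ≤ (N : ℤ) ^ 2 ∧ enormSq k ≤ (N : ℤ) ^ 2}

/-- The set `W^N(k)` of weakly resonant triples at height `N`:
`k₁ + k₂ = k₃ + k`, `|λ_{k₁} + λ_{k₂} − λ_{k₃} − λ_k| ≤ 1`, and `|k₁| > N` or `|k₃| > N`. -/
def WNset (ω : ℝ × ℝ) (N : ℕ) (k : ℤ × ℤ) : Set ((ℤ × ℤ) × (ℤ × ℤ) × (ℤ × ℤ)) :=
  {p | p.1 + p.2.1 = p.2.2 + k ∧
    |freq ω p.1 + freq ω p.2.1 - freq ω p.2.2 - freq ω k| ≤ 1 ∧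
    ((N : ℤ) ^ 2 < enormSq p.1 ∨ (N : ℤ) ^ 2 < enormSq p.2.2)}

/-- The cubic monomial `x_{k₁} · x_{k₂} · conj(x_{k₃})` attached to a triple. -/
noncomputable def monom (x : ℤ × ℤ → ℂ) (p : (ℤ × ℤ) × (ℤ × ℤ) × (ℤ × ℤ)) : ℂ :=
  x p.1 * x p.2.1 * conj (x p.2.2)

/-- The oscillating factor `exp(i(λ_{k₁} + λ_{k₂} − λ_{k₃} − λ_k)t)`. -/
noncomputable def oscFactor (ω : ℝ × ℝ) (k : ℤ × ℤ)
    (p : (ℤ × ℤ) × (ℤ × ℤ) × (ℤ × ℤ)) (t : ℝ) : ℂ :=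
  Complex.exp (Complex.I *
    ((freq ω p.1 + freq ω p.2.1 - freq ω p.2.2 - freq ω k : ℝ) : ℂ) * (t : ℂ))

/-- `u` solves the truncated resonant system at height `N` on `[0, T]`: for each
`t ∈ [0, T]` and `k ∈ ℤ²`, both sums converge absolutely and
`i·(d/dt)u_k(t) = ∑_{R^N(k)} u_{k₁}u_{k₂}conj(u_{k₃})
 + ∑_{W^N(k)} u_{k₁}u_{k₂}conj(u_{k₃}) e^{i(λ_{k₁}+λ_{k₂}−λ_{k₃}−λ_k)t}`. -/
def SolvesTruncated (ω : ℝ × ℝ) (N : ℕ) (T : ℝ) (u : ℝ → (ℤ × ℤ) → ℂ) : Prop :=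
  ∀ t ∈ Set.Icc (0 : ℝ) T, ∀ k : ℤ × ℤ,
    Summable (fun p : RNset ω N k => ‖monom (u t) p.1‖) ∧
    Summable (fun p : WNset ω N k => ‖monom (u t) p.1‖) ∧
    HasDerivWithinAt (fun τ => u τ k)
      (-Complex.I * ((∑' p : RNset ω N k, monom (u t) p.1) +
        ∑' p : WNset ω N k, monom (u t) p.1 * oscFactor ω k p.1 t))
      (Set.Icc (0 : ℝ) T) t

/-- The Sobolev weight `(1 + |n|²)^s` for `n ∈ ℤ²`. -/
noncomputable def hsWeight (s : ℝ) (n : ℤ × ℤ) : ℝ :=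
  (1 + (n.1 : ℝ) ^ 2 + (n.2 : ℝ) ^ 2) ^ s

/-- Membership in `h^s(ℤ²)`: `∑ₙ |xₙ|² (1 + |n|²)^s < ∞`. -/
def InHs (s : ℝ) (x : ℤ × ℤ → ℂ) : Prop :=
  Summable (fun n : ℤ × ℤ => ‖x n‖ ^ 2 * hsWeight s n)

/-- The `h^s(ℤ²)` norm `‖x‖_s = (∑ₙ |xₙ|² (1 + |n|²)^s)^{1/2}`. -/
noncomputable def hsNorm (s : ℝ) (x : ℤ × ℤ → ℂ) : ℝ :=
  Real.sqrt (∑' n : ℤ × ℤ, ‖x n‖ ^ 2 * hsWeight s n)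

/-- Continuity of `u : [0, T] → h^s(ℤ²)` in the `h^s` norm. -/
def HsContOn (s T : ℝ) (u : ℝ → (ℤ × ℤ) → ℂ) : Prop :=
  ∀ t ∈ Set.Icc (0 : ℝ) T, ∀ ε > (0 : ℝ), ∃ δ > (0 : ℝ),
    ∀ t' ∈ Set.Icc (0 : ℝ) T, |t' - t| < δ →
      hsNorm s (fun k => u t' k - u t k) < ε

/-- `f' : [0, T] → h^s(ℤ²)` is the derivative of `f : [0, T] → h^s(ℤ²)` in the
`h^s` norm, at every point of `[0, T]`. -/
def HsDerivOn (s T : ℝ) (f f' : ℝ → (ℤ × ℤ) → ℂ) : Prop :=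
  ∀ t ∈ Set.Icc (0 : ℝ) T, ∀ ε > (0 : ℝ), ∃ δ > (0 : ℝ),
    ∀ t' ∈ Set.Icc (0 : ℝ) T, |t' - t| < δ →
      hsNorm s (fun k => f t' k - f t k - ((t' - t : ℝ) : ℂ) * f' t k) ≤ ε * |t' - t|

/-- The box `Q_M = {k ∈ ℤ² : max(|k⁽¹⁾|, |k⁽²⁾|) ≤ M}`. -/
def QBox (M : ℕ) : Set (ℤ × ℤ) := {k : ℤ × ℤ | max |k.1| |k.2| ≤ (M : ℤ)}

open scoped ENNReal

theorem IsIrrationalPair.eq_zero {ω : ℝ × ℝ} (h : IsIrrationalPair ω) {a b : ℤ}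
    (hab : ω.1 * (a : ℝ) + ω.2 * (b : ℝ) = 0) : a = 0 ∧ b = 0 := by
  by_contra hne
  refine h (a, b) (fun h0 => hne ?_) hab
  simpa using h0

/-- If `a + b = c + d` and `a² + b² = c² + d²`, then `d` is one of `a`, `b`. -/
theorem eq_or_eq_of_add_eq_of_sq_add_sq_eq {a b c d : ℤ} (h1 : a + b = c + d)
    (h2 : a ^ 2 + b ^ 2 - c ^ 2 - d ^ 2 = 0) : d = a ∨ d = b := by
  obtain rfl : c = a + b - d := by linarith
  have h : (d - a) * (d - b) = 0 := by linarith
  rcases mul_eq_zero.1 h with h | h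
  · exact Or.inl (by linarith)
  · exact Or.inr (by linarith)

/-- Boxes are closed under exact resonances. -/
theorem mem_QBox_of_mem_RNset {ω : ℝ × ℝ} (hirr : IsIrrationalPair ω) {M N : ℕ} {k : ℤ × ℤ}
    {p : (ℤ × ℤ) × (ℤ × ℤ) × (ℤ × ℤ)} (hp : p ∈ RNset ω N k)
    (h1 : p.1 ∈ QBox M) (h2 : p.2.1 ∈ QBox M) : k ∈ QBox M := by
  obtain ⟨⟨a1, a2⟩, ⟨b1, b2⟩, c1, c2⟩ := p
  obtain ⟨d1, d2⟩ := k
  obtain ⟨hs, hf, -⟩ := hp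
  simp only [freq, Prod.mk_add_mk, Prod.mk.injEq] at hs hf
  have hz := hirr.eq_zero (a := a1 ^ 2 + b1 ^ 2 - c1 ^ 2 - d1 ^ 2)
    (b := a2 ^ 2 + b2 ^ 2 - c2 ^ 2 - d2 ^ 2) (by push_cast; linarith)
  simp only [QBox, Set.mem_ofPred_eq, max_le_iff] at *
  constructor
  · rcases eq_or_eq_of_add_eq_of_sq_add_sq_eq hs.1 hz.1 with rfl | rfl
    exacts [h1.1, h2.1]
  · rcases eq_or_eq_of_add_eq_of_sq_add_sq_eq hs.2 hz.2 with rfl | rfl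
    exacts [h1.2, h2.2]

theorem enormSq_le_of_mem_QBox {M N : ℕ} (hMN : 3 * M ≤ N) {k : ℤ × ℤ} (hk : k ∈ QBox M) :
    enormSq k ≤ (N : ℤ) ^ 2 := by
  simp only [QBox, Set.mem_ofPred_eq, max_le_iff] at hk
  have h1 : k.1 ^ 2 ≤ (M : ℤ) ^ 2 := sq_le_sq.2 (by simpa using hk.1)
  have h2 : k.2 ^ 2 ≤ (M : ℤ) ^ 2 := sq_le_sq.2 (by simpa using hk.2)
  have h3 : (3 * M : ℤ) ≤ N := by exact_mod_cast hMN
  have h4 : (0 : ℤ) ≤ M := by positivity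
  unfold enormSq
  nlinarith

/-- The right-hand side of the truncated resonant system. -/
noncomputable def resonantField (ω : ℝ × ℝ) (N : ℕ) (t : ℝ) (x : ℤ × ℤ → ℂ) (k : ℤ × ℤ) : ℂ :=
  -Complex.I * ((∑' p : RNset ω N k, monom x p.1) +
    ∑' p : WNset ω N k, monom x p.1 * oscFactor ω k p.1 t)

theorem enorm_oscFactor (ω : ℝ × ℝ) (k : ℤ × ℤ) (p : (ℤ × ℤ) × (ℤ × ℤ) × (ℤ × ℤ)) (t : ℝ) :
    ‖oscFactor ω k p t‖ₑ = 1 := by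
  have h : ‖oscFactor ω k p t‖ = 1 := by
    rw [oscFactor, mul_assoc, mul_comm, ← Complex.ofReal_mul]
    exact Complex.norm_exp_ofReal_mul_I _
  rw [← ofReal_norm, h, ENNReal.ofReal_one]

/-- The sum of the three cubic monomials in `‖x‖` in which one factor is replaced by its
restriction to `P`. -/
noncomputable def cubicMajorant (P : Set (ℤ × ℤ)) (x : ℤ × ℤ → ℂ)
    (p : (ℤ × ℤ) × (ℤ × ℤ) × (ℤ × ℤ)) : ℝ≥0∞ :=
  ‖P.indicator x p.1‖ₑ * (‖x p.2.1‖ₑ * ‖x p.2.2‖ₑ) +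
    ‖x p.1‖ₑ * (‖P.indicator x p.2.1‖ₑ * ‖x p.2.2‖ₑ) +
    ‖x p.1‖ₑ * (‖x p.2.1‖ₑ * ‖P.indicator x p.2.2‖ₑ)

theorem tsum_mul_mul_prod {α : Type*} (f g h : α → ℝ≥0∞) :
    ∑' p : α × α × α, f p.1 * (g p.2.1 * h p.2.2) =
      (∑' a, f a) * ((∑' a, g a) * ∑' a, h a) := by
  simp only [ENNReal.tsum_prod', ENNReal.tsum_mul_left, ENNReal.tsum_mul_right]

theorem tsum_cubicMajorant (P : Set (ℤ × ℤ)) (x : ℤ × ℤ → ℂ) :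
    ∑' p, cubicMajorant P x p = 3 * (∑' k, ‖x k‖ₑ) ^ 2 * ∑' k, ‖P.indicator x k‖ₑ := by
  unfold cubicMajorant
  rw [ENNReal.tsum_add, ENNReal.tsum_add,
    tsum_mul_mul_prod (fun a => ‖P.indicator x a‖ₑ) (fun a => ‖x a‖ₑ) (fun a => ‖x a‖ₑ),
    tsum_mul_mul_prod (fun a => ‖x a‖ₑ) (fun a => ‖P.indicator x a‖ₑ) (fun a => ‖x a‖ₑ),
    tsum_mul_mul_prod (fun a => ‖x a‖ₑ) (fun a => ‖x a‖ₑ) (fun a => ‖P.indicator x a‖ₑ)]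
  ring

theorem enorm_monom_le_cubicMajorant {P : Set (ℤ × ℤ)} (x : ℤ × ℤ → ℂ)
    {p : (ℤ × ℤ) × (ℤ × ℤ) × (ℤ × ℤ)} (hp : p.1 ∈ P ∨ p.2.1 ∈ P ∨ p.2.2 ∈ P) :
    ‖monom x p‖ₑ ≤ cubicMajorant P x p := by
  have h : ‖monom x p‖ₑ = ‖x p.1‖ₑ * (‖x p.2.1‖ₑ * ‖x p.2.2‖ₑ) := by
    rw [monom, enorm_mul, enorm_mul, mul_assoc]
    congr 2
    rw [← ofReal_norm, ← ofReal_norm, RCLike.norm_conj]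
  rw [h, cubicMajorant]
  rcases hp with hp | hp | hp
  · rw [Set.indicator_of_mem hp, add_assoc]
    exact le_self_add
  · rw [Set.indicator_of_mem hp, add_right_comm]
    exact le_add_self
  · rw [Set.indicator_of_mem hp]
    exact le_add_self

/-- Outside `Q_M` the vector field is controlled linearly by the part of `x` outside `Q_M`. -/
theorem tsum_enorm_resonantField_le {ω : ℝ × ℝ} (hirr : IsIrrationalPair ω) {M N : ℕ}
    (hMN : 3 * M ≤ N) (t : ℝ) (x : ℤ × ℤ → ℂ) :
    ∑' k, ‖(QBox M)ᶜ.indicator (resonantField ω N t x) k‖ₑ ≤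
      6 * (∑' k, ‖x k‖ₑ) ^ 2 * ∑' k, ‖(QBox M)ᶜ.indicator x k‖ₑ := by
  let σ : (ℤ × ℤ) × (ℤ × ℤ) × (ℤ × ℤ) → ℤ × ℤ := fun p => p.1 + p.2.1 - p.2.2
  have hσ : ∀ (p : (ℤ × ℤ) × (ℤ × ℤ) × (ℤ × ℤ)) (k : ℤ × ℤ), p.1 + p.2.1 = p.2.2 + k →
      p ∈ σ ⁻¹' {k} := fun p k h => by
    simp only [σ, Set.mem_preimage, Set.mem_singleton_iff, h, add_sub_cancel_left]
  have key : ∀ k, ‖(QBox M)ᶜ.indicator (resonantField ω N t x) k‖ₑ ≤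
      2 * ∑' p : σ ⁻¹' {k}, cubicMajorant (QBox M)ᶜ x p := by
    intro k
    by_cases hk : k ∈ QBox M
    · rw [Set.indicator_of_notMem (by simpa using hk)]
      simp
    rw [Set.indicator_of_mem (by simpa using hk), resonantField, enorm_mul, two_mul]
    have hI : ‖-Complex.I‖ₑ = 1 := by
      rw [← ofReal_norm]; simp
    rw [hI, one_mul]
    refine (enorm_add_le _ _).trans (add_le_add ?_ ?_)
    · refine enorm_tsum_le_tsum_enorm.trans ?_
      refine le_trans (ENNReal.tsum_le_tsum fun p =>
        enorm_monom_le_cubicMajorant (P := (QBox M)ᶜ) x ?_)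
        (ENNReal.tsum_mono_subtype _ fun p hp => hσ p k hp.1)
      by_contra hne
      simp only [Set.mem_compl_iff, not_or, not_not] at hne
      exact hk (mem_QBox_of_mem_RNset hirr p.2 hne.1 hne.2.1)
    · refine enorm_tsum_le_tsum_enorm.trans ?_
      refine le_trans (ENNReal.tsum_le_tsum fun p => ?_)
        (ENNReal.tsum_mono_subtype (cubicMajorant (QBox M)ᶜ x) fun p hp => hσ p k hp.1)
      rw [enorm_mul, enorm_oscFactor, mul_one]
      refine enorm_monom_le_cubicMajorant x ?_
      rcases p.2.2.2 with h | h
      · exact Or.inl fun hq => (enormSq_le_of_mem_QBox hMN hq).not_gt h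
      · exact Or.inr (Or.inr fun hq => (enormSq_le_of_mem_QBox hMN hq).not_gt h)
  refine (ENNReal.tsum_le_tsum key).trans (le_of_eq ?_)
  rw [ENNReal.tsum_mul_left, ENNReal.tsum_fiberwise, tsum_cubicMajorant]
  ring

theorem hsWeight_pos (s : ℝ) (n : ℤ × ℤ) : 0 < hsWeight s n := by
  unfold hsWeight; positivity

theorem summable_one_add_sq_rpow {s : ℝ} (hs : 1 < s) :
    Summable fun a : ℤ => (1 + (a : ℝ) ^ 2) ^ (-(s / 2)) := by
  refine Summable.of_norm_bounded_eventually (Real.summable_abs_int_rpow hs) ?_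
  filter_upwards [Set.Finite.compl_mem_cofinite (Set.finite_singleton (0 : ℤ))] with a ha
  have ha : (a : ℝ) ≠ 0 := by simpa using ha
  have hpos : 0 < |(a : ℝ)| := abs_pos.2 ha
  rw [Real.norm_of_nonneg (by positivity)]
  calc (1 + (a : ℝ) ^ 2) ^ (-(s / 2)) ≤ (|(a : ℝ)| ^ (2 : ℝ)) ^ (-(s / 2)) := by
        refine Real.rpow_le_rpow_of_nonpos (by positivity) ?_ (by linarith)
        rw [Real.rpow_two, sq_abs]; linarith
    _ = |(a : ℝ)| ^ (-s) := by
        rw [← Real.rpow_mul hpos.le]; congr 1; ring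

theorem summable_inv_hsWeight {s : ℝ} (hs : 1 < s) :
    Summable fun n : ℤ × ℤ => (hsWeight s n)⁻¹ := by
  have h := summable_one_add_sq_rpow hs
  refine Summable.of_nonneg_of_le (fun n => (inv_pos.2 (hsWeight_pos s n)).le) (fun n => ?_)
    (h.mul_of_nonneg h (fun _ => by positivity) (fun _ => by positivity))
  have hab : (0 : ℝ) < 1 + (n.1 : ℝ) ^ 2 + (n.2 : ℝ) ^ 2 := by positivity
  rw [hsWeight, ← Real.rpow_neg hab.le, ← Real.mul_rpow (by positivity) (by positivity)]
  calc (1 + (n.1 : ℝ) ^ 2 + (n.2 : ℝ) ^ 2) ^ (-s)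
      = ((1 + (n.1 : ℝ) ^ 2 + (n.2 : ℝ) ^ 2) ^ (2 : ℝ)) ^ (-(s / 2)) := by
        rw [← Real.rpow_mul hab.le]; congr 1; ring
    _ ≤ ((1 + (n.1 : ℝ) ^ 2) * (1 + (n.2 : ℝ) ^ 2)) ^ (-(s / 2)) := by
        refine Real.rpow_le_rpow_of_nonpos (by positivity) ?_ (by linarith)
        rw [Real.rpow_two]
        nlinarith [sq_nonneg (n.1 : ℝ), sq_nonneg (n.2 : ℝ),
          mul_nonneg (sq_nonneg (n.1 : ℝ)) (sq_nonneg (n.2 : ℝ))]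

/-- For `s > 1` the space `h^s(ℤ²)` embeds in `ℓ¹(ℤ²)`. -/
theorem InHs.summable_norm_and_tsum_le {s : ℝ} (hs : 1 < s) {x : ℤ × ℤ → ℂ} (hx : InHs s x) :
    (Summable fun n => ‖x n‖) ∧
      ∑' n, ‖x n‖ ≤ hsNorm s x * Real.sqrt (∑' n, (hsWeight s n)⁻¹) := by
  have hw := fun n => hsWeight_pos s n
  have h1 : ∀ n, (‖x n‖ * Real.sqrt (hsWeight s n)) ^ (2 : ℝ) = ‖x n‖ ^ 2 * hsWeight s n :=
    fun n => by rw [Real.rpow_two, mul_pow, Real.sq_sqrt (hw n).le]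
  have h2 : ∀ n, (Real.sqrt (hsWeight s n)⁻¹) ^ (2 : ℝ) = (hsWeight s n)⁻¹ :=
    fun n => by rw [Real.rpow_two, Real.sq_sqrt (inv_pos.2 (hw n)).le]
  have h3 : ∀ n, ‖x n‖ * Real.sqrt (hsWeight s n) * Real.sqrt (hsWeight s n)⁻¹ = ‖x n‖ :=
    fun n => by
      rw [Real.sqrt_inv, mul_assoc, mul_inv_cancel₀ (Real.sqrt_pos.2 (hw n)).ne', mul_one]
  have h := Real.summable_and_inner_le_Lp_mul_Lq_tsum_of_nonneg Real.HolderConjugate.two_two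
    (f := fun n => ‖x n‖ * Real.sqrt (hsWeight s n)) (g := fun n => Real.sqrt (hsWeight s n)⁻¹)
    (fun _ => by positivity) (fun _ => by positivity)
    (by simpa only [h1, InHs] using hx) (by simpa only [h2] using summable_inv_hsWeight hs)
  simpa only [h1, h2, h3, hsNorm, ← Real.sqrt_eq_rpow] using h

theorem InHs.sub_sub_mul {s : ℝ} {x y z : ℤ × ℤ → ℂ} (hx : InHs s x) (hy : InHs s y)
    (hz : InHs s z) (c : ℂ) : InHs s fun k => x k - y k - c * z k := by
  refine Summable.of_nonneg_of_le (fun n => mul_nonneg (sq_nonneg _) (hsWeight_pos s n).le)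
    (fun n => ?_) (((hx.add hy).add (hz.mul_left (‖c‖ ^ 2))).mul_left 3)
  have h : ‖x n - y n - c * z n‖ ≤ ‖x n‖ + ‖y n‖ + ‖c‖ * ‖z n‖ := by
    rw [← norm_mul]
    exact (norm_sub_le _ _).trans (add_le_add_left (norm_sub_le _ _) _)
  have h' : ‖x n - y n - c * z n‖ ^ 2 ≤ 3 * (‖x n‖ ^ 2 + ‖y n‖ ^ 2 + ‖c‖ ^ 2 * ‖z n‖ ^ 2) := by
    refine (pow_le_pow_left₀ (norm_nonneg _) h 2).trans ?_
    nlinarith [sq_nonneg (‖x n‖ - ‖y n‖), sq_nonneg (‖x n‖ - ‖c‖ * ‖z n‖),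
      sq_nonneg (‖y n‖ - ‖c‖ * ‖z n‖)]
  exact (mul_le_mul_of_nonneg_right h' (hsWeight_pos s n).le).trans_eq (by ring)

open scoped Classical in
/-- The element of `ℓ¹(ℤ²)` with the given coordinates (zero if they are not summable). -/
noncomputable def toEll1 (x : ℤ × ℤ → ℂ) : lp (fun _ : ℤ × ℤ => ℂ) 1 :=
  if h : Memℓp x 1 then ⟨x, h⟩ else 0

theorem toEll1_apply {x : ℤ × ℤ → ℂ} (hx : Summable fun n => ‖x n‖) (k : ℤ × ℤ) :
    toEll1 x k = x k := by
  have h : Memℓp x 1 := memℓp_gen (by simpa using hx)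
  rw [toEll1, dif_pos h]

theorem norm_ell1_eq_tsum (X : lp (fun _ : ℤ × ℤ => ℂ) 1) : ‖X‖ = ∑' k, ‖X k‖ := by
  rw [lp.norm_eq_tsum_rpow (by simp)]
  simp

theorem enorm_toEll1 {x : ℤ × ℤ → ℂ} (hx : Summable fun n => ‖x n‖) :
    ‖toEll1 x‖ₑ = ∑' k, ‖x k‖ₑ := by
  rw [← ofReal_norm, norm_ell1_eq_tsum]
  simp only [toEll1_apply hx]
  rw [ENNReal.ofReal_tsum_of_nonneg (fun _ => norm_nonneg _) hx]
  simp only [ofReal_norm]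

theorem summable_norm_indicator {P : Set (ℤ × ℤ)} {x : ℤ × ℤ → ℂ}
    (hx : Summable fun n => ‖x n‖) : Summable fun n => ‖P.indicator x n‖ :=
  Summable.of_nonneg_of_le (fun _ => norm_nonneg _) (fun n => norm_indicator_le_norm_self x n) hx

/-- An `h^s`-derivative restricts to an `ℓ¹`-derivative on every set of modes. -/
theorem HsDerivOn.hasDerivWithinAt_toEll1 {s T : ℝ} (hs : 1 < s) {f f' : ℝ → ℤ × ℤ → ℂ}
    (hf : ∀ t ∈ Set.Icc (0 : ℝ) T, InHs s (f t)) (hf' : ∀ t ∈ Set.Icc (0 : ℝ) T, InHs s (f' t))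
    (h : HsDerivOn s T f f') (P : Set (ℤ × ℤ)) {t : ℝ} (ht : t ∈ Set.Icc (0 : ℝ) T) :
    HasDerivWithinAt (fun τ => toEll1 (P.indicator (f τ))) (toEll1 (P.indicator (f' t)))
      (Set.Icc 0 T) t := by
  rw [hasDerivWithinAt_iff_isLittleO, Asymptotics.isLittleO_iff]
  intro c hc
  set A := Real.sqrt (∑' n, (hsWeight s n)⁻¹)
  have hA : 0 ≤ A := Real.sqrt_nonneg _
  obtain ⟨δ, hδ, hb⟩ := h t ht (c / (A + 1)) (by positivity)
  filter_upwards [self_mem_nhdsWithin,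
    mem_nhdsWithin_of_mem_nhds (Metric.ball_mem_nhds t hδ)] with τ hτ hτδ
  have hsum := fun {r} hr => (hf r hr).summable_norm_and_tsum_le hs |>.1
  have hd := (hf τ hτ).sub_sub_mul (hf t ht) (hf' t ht) ((τ - t : ℝ) : ℂ)
  have hd1 := hd.summable_norm_and_tsum_le hs
  have hcoord : ∀ k, ‖(toEll1 (P.indicator (f τ)) - toEll1 (P.indicator (f t)) -
      (τ - t) • toEll1 (P.indicator (f' t)) : lp (fun _ : ℤ × ℤ => ℂ) 1) k‖ ≤
      ‖f τ k - f t k - ((τ - t : ℝ) : ℂ) * f' t k‖ := by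
    intro k
    simp only [lp.coeFn_sub, lp.coeFn_smul, Pi.sub_apply, Pi.smul_apply]
    rw [toEll1_apply (summable_norm_indicator (hsum hτ)),
      toEll1_apply (summable_norm_indicator (hsum ht)),
      toEll1_apply (summable_norm_indicator ((hf' t ht).summable_norm_and_tsum_le hs).1)]
    by_cases hk : k ∈ P
    · simp [hk]
    · simp [hk]
  rw [norm_ell1_eq_tsum, Real.norm_eq_abs]
  have hS := Summable.of_nonneg_of_le (fun _ => norm_nonneg _) hcoord hd1.1
  calc _ ≤ ∑' k, ‖f τ k - f t k - ((τ - t : ℝ) : ℂ) * f' t k‖ := hS.tsum_le_tsum hcoord hd1.1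
    _ ≤ c / (A + 1) * |τ - t| * A :=
        hd1.2.trans (mul_le_mul_of_nonneg_right
          (hb τ hτ (by simpa [Real.dist_eq] using hτδ)) hA)
    _ = c * |τ - t| * (A / (A + 1)) := by ring
    _ ≤ c * |τ - t| * 1 := by
        gcongr
        rw [div_le_one (by positivity)]
        linarith
    _ = c * |τ - t| := mul_one _

theorem HsDerivOn.hasDerivWithinAt_apply {s T : ℝ} (hs : 1 < s) {f f' : ℝ → ℤ × ℤ → ℂ}
    (hf : ∀ t ∈ Set.Icc (0 : ℝ) T, InHs s (f t)) (hf' : ∀ t ∈ Set.Icc (0 : ℝ) T, InHs s (f' t))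
    (h : HsDerivOn s T f f') (k : ℤ × ℤ) {t : ℝ} (ht : t ∈ Set.Icc (0 : ℝ) T) :
    HasDerivWithinAt (fun τ => f τ k) (f' t k) (Set.Icc 0 T) t := by
  have hd := h.hasDerivWithinAt_toEll1 hs hf hf' Set.univ ht
  simp only [Set.indicator_univ] at hd
  have he := (lp.evalCLM ℝ (fun _ : ℤ × ℤ => ℂ) 1 k).hasFDerivAt.comp_hasDerivWithinAt t hd
  have happ : ∀ X : lp (fun _ : ℤ × ℤ => ℂ) 1,
      lp.evalCLM ℝ (fun _ : ℤ × ℤ => ℂ) 1 k X = X k := fun _ => rfl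
  rw [happ, toEll1_apply ((hf' t ht).summable_norm_and_tsum_le hs).1] at he
  refine he.congr (fun τ hτ => ?_) ?_
  · exact (toEll1_apply ((hf τ hτ).summable_norm_and_tsum_le hs).1 k).symm
  · exact (toEll1_apply ((hf t ht).summable_norm_and_tsum_le hs).1 k).symm

/-- A differentiable `h^s`-valued solution whose initial datum is supported in `Q_M` stays
supported in `Q_M` on the whole time interval. -/
theorem SolvesTruncated.eq_zero_of_notMem_QBox {s T : ℝ} (hs : 1 < s) (hT : 0 < T) {ω : ℝ × ℝ}
    (hirr : IsIrrationalPair ω) {M N : ℕ} (hMN : 3 * M ≤ N) {u u' : ℝ → ℤ × ℤ → ℂ}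
    (hu : ∀ t ∈ Set.Icc (0 : ℝ) T, InHs s (u t)) (hu' : ∀ t ∈ Set.Icc (0 : ℝ) T, InHs s (u' t))
    (hderiv : HsDerivOn s T u u') (hsol : SolvesTruncated ω N T u)
    (hsupp : ∀ k, k ∉ QBox M → u 0 k = 0) {t : ℝ} (ht : t ∈ Set.Icc (0 : ℝ) T) {k : ℤ × ℤ}
    (hk : k ∉ QBox M) : u t k = 0 := by
  have hsum := fun r hr => ((hu r hr).summable_norm_and_tsum_le hs).1
  have hfield : ∀ r ∈ Set.Icc (0 : ℝ) T, u' r = resonantField ω N r (u r) := fun r hr =>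
    funext fun j => (uniqueDiffOn_Icc hT r hr).eq_deriv _
      (hderiv.hasDerivWithinAt_apply hs hu hu' j hr) (hsol r hr j).2.2
  have hcont : ContinuousOn (fun τ => toEll1 (u τ)) (Set.Icc 0 T) := fun r hr => by
    simpa using (hderiv.hasDerivWithinAt_toEll1 hs hu hu' Set.univ hr).continuousWithinAt
  obtain ⟨C, hC⟩ := isCompact_Icc.exists_bound_of_continuousOn hcont
  have hV := fun r hr => hderiv.hasDerivWithinAt_toEll1 hs hu hu' (QBox M)ᶜ (t := r) hr
  have hzero := eq_zero_of_abs_deriv_le_mul_abs_self_of_eq_zero_right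
    (f := fun τ => toEll1 ((QBox M)ᶜ.indicator (u τ)))
    (f' := fun τ => toEll1 ((QBox M)ᶜ.indicator (u' τ))) (K := 6 * C ^ 2) (a := 0) (b := T)
    (fun r hr => (hV r hr).continuousWithinAt)
    (fun r hr => (hV r (Set.Ico_subset_Icc_self hr)).mono_of_mem_nhdsWithin
      (Icc_mem_nhdsGE_of_mem hr)) ?_ ?_ t ht
  · have h := toEll1_apply (summable_norm_indicator (P := (QBox M)ᶜ) (hsum t ht)) k
    rw [hzero, Set.indicator_of_mem (by simpa using hk)] at h
    simpa using h.symm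
  · have h0 : (0 : ℝ) ∈ Set.Icc 0 T := ⟨le_rfl, hT.le⟩
    ext j
    rw [toEll1_apply (summable_norm_indicator (hsum 0 h0))]
    by_cases hj : j ∈ QBox M
    · simp [hj]
    · simp [hj, hsupp j hj]
  · intro r hr
    have hr := Set.Ico_subset_Icc_self hr
    have h := tsum_enorm_resonantField_le hirr hMN r (u r)
    rw [← hfield r hr, ← enorm_toEll1 (hsum r hr),
      ← enorm_toEll1 (summable_norm_indicator (hsum r hr)),
      ← enorm_toEll1 (summable_norm_indicator ((hu' r hr).summable_norm_and_tsum_le hs).1)] at h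
    have h' := ENNReal.toReal_mono (by finiteness) h
    simp only [ENNReal.toReal_mul, ENNReal.toReal_pow, toReal_enorm, ENNReal.toReal_ofNat] at h'
    refine h'.trans ?_
    have := hC r hr
    gcongr

/-- Lemma 5.2 of the paper (no cascade): if `u` is an infinitely differentiable
`h^s`-valued solution of the truncated resonant system at height `N ≥ 3M` whose
initial datum is supported in `Q_M`, then all time derivatives of the modes outside
`Q_M` vanish at `t = 0`.  The infinite `h^s`-differentiability is witnessed by the
tower `D` of iterated `h^s`-derivatives, `D 0 = u`; the conclusion states that the
`n`-th derivative `D n` vanishes at `0` outside `Q_M`. -/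
theorem stmt_17 (s : ℝ) (hs : 1 < s) (ω : ℝ × ℝ) (hω1 : 0 < ω.1) (hω2 : 0 < ω.2)
    (hirr : IsIrrationalPair ω) (M N : ℕ) (hM : 0 < M) (hMN : 3 * M ≤ N)
    (T : ℝ) (hT : 0 < T) (u : ℝ → (ℤ × ℤ) → ℂ) (D : ℕ → ℝ → (ℤ × ℤ) → ℂ)
    (hD0 : D 0 = u)
    (hDmem : ∀ n : ℕ, ∀ t ∈ Set.Icc (0 : ℝ) T, InHs s (D n t))
    (hDderiv : ∀ n : ℕ, HsDerivOn s T (D n) (D (n + 1)))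
    (hsol : SolvesTruncated ω N T u)
    (hsupp : ∀ k : ℤ × ℤ, k ∉ QBox M → u 0 k = 0) :
    ∀ k : ℤ × ℤ, k ∉ QBox M → ∀ n : ℕ, D n 0 k = 0 := by
  have hvanish : ∀ n : ℕ, ∀ t ∈ Set.Icc (0 : ℝ) T, ∀ k : ℤ × ℤ, k ∉ QBox M → D n t k = 0 := by
    intro n
    induction n with
    | zero =>
      intro t ht k hk
      subst hD0
      exact hsol.eq_zero_of_notMem_QBox hs hT hirr hMN (hDmem 0) (hDmem 1) (hDderiv 0) hsupp ht hk
    | succ n ih =>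
      intro t ht k hk
      have hd := (hDderiv n).hasDerivWithinAt_apply hs (hDmem n) (hDmem (n + 1)) k ht
      exact (uniqueDiffOn_Icc hT t ht).eq_deriv _ hd
        ((hasDerivWithinAt_const t (Set.Icc 0 T) (0 : ℂ)).congr (fun τ hτ => ih τ hτ k hk)
          (ih t ht k hk))
  exact fun k hk n => hvanish n 0 ⟨le_rfl, hT.le⟩ k hk
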